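/- Let γ(x) = ∫₀^π cos(xt)/(1 − φ(t)) dt. Then the limit of √x · γ(x) as x → ∞ (x real) exists and is a nonzero real number. -/

import Mathlib

open Filter Real Complex

noncomputable section

/-- `w(t) = 3 - 2 exp(it)`. -/
def wFn (t : ℝ) : ℂ := 3 - 2 * Complex.exp (Complex.I * t)

/-- `φ(t) = Re(w(t)² - w(t)·√(w(t)²-1))` (principal branch of the complex square root). -/
def phiFn (t : ℝ) : ℝ := (wFn t ^ 2 - wFn t * (wFn t ^ 2 - 1) ^ ((1 : ℂ) / 2)).re

/-- `γ(x) = ∫₀^π cos(xt)/(1 - φ(t)) dt`. -/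
def gammaFn (x : ℝ) : ℝ := ∫ t in (0 : ℝ)..Real.pi, Real.cos (x * t) / (1 - phiFn t)

/-- The Fresnel integral. -/
def fres (u : ℝ) : ℝ := ∫ v in (0 : ℝ)..u, Real.cos (v ^ 2)

def kk (v : ℝ) : ℝ := (1 - Real.cos (v ^ 2)) / v ^ 4

def pp (u : ℝ) : ℝ := Real.sin (u ^ 2) / (2 * u) + (1 - Real.cos (u ^ 2)) / (4 * u ^ 3)

lemma kk_nonneg (v : ℝ) : 0 ≤ kk v := by
  unfold kk
  have := Real.cos_le_one (v ^ 2)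
  apply div_nonneg (by linarith) (by positivity)

lemma kk_le (v : ℝ) : kk v ≤ 4 * (1 + v ^ 2)⁻¹ := by
  unfold kk
  rcases eq_or_ne v 0 with rfl | hv
  · simp
  have hv2 : 0 < v ^ 2 := by positivity
  rw [← div_eq_mul_inv, div_le_div_iff₀ (by positivity) (by positivity)]
  have h1 := Real.one_sub_sq_div_two_le_cos (x := v ^ 2)
  have h2 := Real.neg_one_le_cos (v ^ 2)
  have h3 : v ^ 4 = (v ^ 2) ^ 2 := by ring
  rw [h3]
  set y := v ^ 2
  rcases le_total y 1 with h | h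
  · nlinarith
  · nlinarith

lemma kk_integrable : MeasureTheory.Integrable kk := by
  refine (integrable_inv_one_add_sq.const_mul 4).mono' ?_ ?_
  · apply Measurable.aestronglyMeasurable
    unfold kk
    fun_prop
  · refine Eventually.of_forall fun v => ?_
    rw [Real.norm_of_nonneg (kk_nonneg v)]
    exact kk_le v

lemma pp_zero : pp 0 = 0 := by simp [pp]

lemma abs_pp_le {u : ℝ} (hu : 0 < u) : |pp u| ≤ u := by
  unfold pp
  have h1 : |Real.sin (u ^ 2)| ≤ u ^ 2 := by
    have := Real.abs_sin_le_abs (x := u ^ 2)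
    rwa [abs_of_nonneg (a := u ^ 2) (by positivity)] at this
  have h2 := Real.one_sub_sq_div_two_le_cos (x := u ^ 2)
  have h3 := Real.cos_le_one (u ^ 2)
  calc _ ≤ |Real.sin (u ^ 2) / (2 * u)| + |(1 - Real.cos (u ^ 2)) / (4 * u ^ 3)| := abs_add_le _ _
    _ ≤ u / 2 + u / 2 := by
      rw [abs_div, abs_div, abs_of_pos (a := 2 * u) (by positivity),
        abs_of_pos (a := 4 * u ^ 3) (by positivity),
        abs_of_nonneg (a := 1 - Real.cos (u ^ 2)) (by linarith)]
      gcongr ?_ + ?_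
      · rw [div_le_div_iff₀ (by positivity) (by positivity)]; nlinarith
      · rw [div_le_div_iff₀ (by positivity) (by positivity)]
        have : 0 < u ^ 4 := by positivity
        nlinarith
    _ = u := by ring

lemma abs_pp_le' {u : ℝ} (hu : 1 ≤ u) : |pp u| ≤ u⁻¹ := by
  unfold pp
  have h1 := Real.abs_sin_le_one (u ^ 2)
  have h2 := Real.neg_one_le_cos (u ^ 2)
  have h3 := Real.cos_le_one (u ^ 2)
  calc _ ≤ |Real.sin (u ^ 2) / (2 * u)| + |(1 - Real.cos (u ^ 2)) / (4 * u ^ 3)| := abs_add_le _ _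
    _ ≤ 1 / (2 * u) + 2 / (4 * u) := by
      rw [abs_div, abs_div, abs_of_pos (a := 2 * u) (by positivity),
        abs_of_pos (a := 4 * u ^ 3) (by positivity),
        abs_of_nonneg (a := 1 - Real.cos (u ^ 2)) (by linarith)]
      gcongr ?_ + ?_
      · gcongr
      · gcongr
        · linarith
        · exact le_self_pow₀ hu (by norm_num)
    _ = u⁻¹ := by field_simp; norm_num

lemma pp_cont : ContinuousOn pp (Set.Ici 0) := by
  intro u hu
  rcases eq_or_lt_of_le (show (0 : ℝ) ≤ u from hu) with h | h
  · subst h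
    rw [ContinuousWithinAt, pp_zero]
    apply squeeze_zero_norm' (a := fun u => |u|)
    · filter_upwards [self_mem_nhdsWithin] with v hv
      rcases eq_or_lt_of_le (show (0 : ℝ) ≤ v from hv) with h | h
      · subst h; simp [pp_zero]
      · rw [Real.norm_eq_abs, abs_of_pos h]; exact abs_pp_le h
    · have : Continuous (fun u : ℝ => |u|) := continuous_abs
      simpa using (this.tendsto 0).mono_left nhdsWithin_le_nhds
  · apply ContinuousAt.continuousWithinAt
    unfold pp
    apply ContinuousAt.add
    · exact ContinuousAt.div (by fun_prop) (by fun_prop) (by positivity)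
    · exact ContinuousAt.div (by fun_prop) (by fun_prop) (by positivity)

lemma pp_deriv {u : ℝ} (hu : 0 < u) :
    HasDerivAt pp (Real.cos (u ^ 2) - 3 / 4 * kk u) u := by
  have hsq : HasDerivAt (fun u : ℝ => u ^ 2) (2 * u) u := by
    simpa using hasDerivAt_pow 2 u
  have h1 := (hsq.sin).div ((hasDerivAt_id u).const_mul 2) (by simp; positivity)
  have h2 := (hsq.cos.const_sub 1).div ((hasDerivAt_pow 3 u).const_mul 4) (by positivity)
  refine (h1.add h2).congr_deriv ?_
  unfold kk
  simp
  field_simp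
  ring

lemma fres_formula {u : ℝ} (hu : 0 ≤ u) :
    fres u = pp u + 3 / 4 * ∫ v in (0 : ℝ)..u, kk v := by
  have hi1 : IntervalIntegrable (fun v : ℝ => Real.cos (v ^ 2)) MeasureTheory.volume 0 u :=
    Continuous.intervalIntegrable (by fun_prop) _ _
  have hi2 : IntervalIntegrable (fun v : ℝ => 3 / 4 * kk v) MeasureTheory.volume 0 u :=
    (kk_integrable.const_mul _).intervalIntegrable
  have := intervalIntegral.integral_eq_sub_of_hasDerivAt_of_le hu
    (pp_cont.mono Set.Icc_subset_Ici_self) (fun x hx => pp_deriv hx.1) (hi1.sub hi2)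
  rw [intervalIntegral.integral_sub hi1 hi2, pp_zero, intervalIntegral.integral_const_mul] at this
  unfold fres
  linarith

lemma fres_tendsto : ∃ c : ℝ, 0 < c ∧ Tendsto fres atTop (nhds c) := by
  refine ⟨3 / 4 * ∫ v in Set.Ioi (0 : ℝ), kk v, ?_, ?_⟩
  · apply mul_pos (by norm_num)
    rw [MeasureTheory.setIntegral_pos_iff_support_of_nonneg_ae
      (Eventually.of_forall kk_nonneg) kk_integrable.integrableOn]
    have : Set.Ioo (0 : ℝ) 1 ⊆ Function.support kk ∩ Set.Ioi 0 := by
      intro v hv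
      refine ⟨?_, hv.1⟩
      have hv0 := hv.1
      have hv1 := hv.2
      have : Real.cos (v ^ 2) < Real.cos 0 :=
        Real.cos_lt_cos_of_nonneg_of_le_pi le_rfl
          (by nlinarith [Real.pi_gt_three]) (by positivity)
      rw [Real.cos_zero] at this
      simp only [Function.mem_support, kk]
      exact (div_pos (by linarith) (by positivity)).ne'
    refine lt_of_lt_of_le ?_ (MeasureTheory.measure_mono this)
    simp
  · have h1 := MeasureTheory.intervalIntegral_tendsto_integral_Ioi (0 : ℝ)
      kk_integrable.integrableOn tendsto_id
    have h2 : Tendsto pp atTop (nhds 0) := by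
      apply squeeze_zero_norm' _ tendsto_inv_atTop_zero
      filter_upwards [eventually_ge_atTop 1] with u hu
      exact abs_pp_le' hu
    have h3 := h2.add (h1.const_mul (3 / 4))
    rw [zero_add] at h3
    refine h3.congr' ?_
    filter_upwards [eventually_ge_atTop 0] with u hu
    exact (fres_formula hu).symm

lemma fres_hasDeriv (u : ℝ) : HasDerivAt fres (Real.cos (u ^ 2)) u := by
  have hc : Continuous (fun v : ℝ => Real.cos (v ^ 2)) := by fun_prop
  exact intervalIntegral.integral_hasDerivAt_right (hc.intervalIntegrable _ _)
    hc.aestronglyMeasurable.stronglyMeasurableAtFilter hc.continuousAt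

lemma fres_cont : Continuous fres :=
  continuous_iff_continuousAt.2 fun u => (fres_hasDeriv u).continuousAt

lemma fres_zero : fres 0 = 0 := by simp [fres]

lemma fres_bdd : ∃ C : ℝ, ∀ u, 0 ≤ u → |fres u| ≤ C := by
  refine ⟨1 + 3 / 4 * ∫ v, kk v, fun u hu => ?_⟩
  have hk : ∀ u : ℝ, 0 ≤ u → |3 / 4 * ∫ v in (0 : ℝ)..u, kk v| ≤ 3 / 4 * ∫ v, kk v := by
    intro u hu
    have h0 : 0 ≤ ∫ v in (0 : ℝ)..u, kk v :=
      intervalIntegral.integral_nonneg hu fun v _ => kk_nonneg v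
    rw [abs_of_nonneg (by positivity), intervalIntegral.integral_of_le hu]
    refine mul_le_mul_of_nonneg_left ?_ (by norm_num)
    exact MeasureTheory.setIntegral_le_integral kk_integrable (Eventually.of_forall kk_nonneg)
  have hp : |pp u| ≤ 1 := by
    rcases eq_or_lt_of_le hu with h | h
    · subst h; simp [pp_zero]
    rcases le_total u 1 with h1 | h1
    · exact (abs_pp_le h).trans h1
    · exact (abs_pp_le' h1).trans (inv_le_one_of_one_le₀ h1)
  rw [fres_formula hu]
  exact (abs_add_le _ _).trans (add_le_add hp (hk u hu))

/-- The main asymptotic lemma. -/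
lemma fres_asymp (h : ℝ → ℝ) (b : ℝ) (hb : 0 < b)
    (hd : ∀ s ∈ Set.Icc 0 b, DifferentiableAt ℝ h s)
    (hc : ContinuousOn (deriv h) (Set.Icc 0 b)) {c : ℝ} (hf : Tendsto fres atTop (nhds c)) :
    Tendsto (fun x : ℝ => √x * ∫ s in (0 : ℝ)..b, Real.cos (x * s ^ 2) * h s) atTop
      (nhds (c * h 0)) := by
  have hu : Set.uIcc 0 b = Set.Icc 0 b := Set.uIcc_of_le hb.le
  have hint : IntervalIntegrable (deriv h) MeasureTheory.volume 0 b := by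
    apply ContinuousOn.intervalIntegrable; rwa [hu]
  have hsq : Tendsto (fun x : ℝ => √x) atTop atTop := Real.tendsto_sqrt_atTop
  have key : ∀ x : ℝ, 0 ≤ x → √x * ∫ s in (0 : ℝ)..b, Real.cos (x * s ^ 2) * h s
      = h b * fres (√x * b) - ∫ s in (0 : ℝ)..b, deriv h s * fres (√x * s) := by
    intro x hx
    have := intervalIntegral.integral_mul_deriv_eq_deriv_mul (a := 0) (b := b) (u := h)
      (u' := deriv h) (v := fun s => fres (√x * s)) (v' := fun s => √x * Real.cos (x * s ^ 2))
      (fun s hs => (hd s (hu ▸ hs)).hasDerivAt) (fun s _ => ?_) hint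
      (Continuous.intervalIntegrable (by fun_prop) _ _)
    · simp only [mul_zero, fres_zero, sub_zero] at this
      rw [← this, ← intervalIntegral.integral_const_mul]
      congr 1; ext s; ring
    · have h1 : HasDerivAt (fun s : ℝ => √x * s) (√x) s := by
        simpa using (hasDerivAt_id s).const_mul (√x)
      have h2 := (fres_hasDeriv (√x * s)).comp s h1
      refine h2.congr_deriv ?_
      rw [mul_pow, Real.sq_sqrt hx, mul_comm]
  obtain ⟨C, hC⟩ := fres_bdd
  have hlim : Tendsto (fun x : ℝ => ∫ s in (0 : ℝ)..b, deriv h s * fres (√x * s)) atTop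
      (nhds (∫ s in (0 : ℝ)..b, deriv h s * c)) := by
    refine intervalIntegral.tendsto_integral_filter_of_dominated_convergence
      (fun s => |deriv h s| * C) ?_ ?_ ?_ ?_
    · refine Eventually.of_forall fun x => ?_
      have hI : IntervalIntegrable (fun s => deriv h s * fres (√x * s)) MeasureTheory.volume 0 b :=
        hint.mul_continuousOn (fres_cont.comp (by fun_prop)).continuousOn
      rw [Set.uIoc_of_le hb.le]
      exact hI.1.aestronglyMeasurable
    · refine Eventually.of_forall fun x => Eventually.of_forall fun s hs => ?_
      rw [Set.uIoc_of_le hb.le] at hs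
      rw [Real.norm_eq_abs, abs_mul]
      gcongr
      exact hC _ (mul_nonneg (Real.sqrt_nonneg _) hs.1.le)
    · exact hint.abs.mul_const C
    · refine Eventually.of_forall fun s hs => ?_
      rw [Set.uIoc_of_le hb.le] at hs
      exact (hf.comp (hsq.atTop_mul_const hs.1)).const_mul _
  have hlim2 := ((hf.comp (hsq.atTop_mul_const hb)).const_mul (h b)).sub hlim
  rw [intervalIntegral.integral_mul_const,
    intervalIntegral.integral_deriv_eq_sub (by rwa [hu]) hint] at hlim2
  have : h b * c - (h b - h 0) * c = c * h 0 := by ring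
  rw [this] at hlim2
  refine hlim2.congr' ?_
  filter_upwards [eventually_ge_atTop 0] with x hx
  exact (key x hx).symm
/-- `(1 - exp(iu))/u`, extended analytically to `u = 0`. -/
def dd : ℂ → ℂ := dslope (fun u : ℂ => 1 - Complex.exp (Complex.I * u)) 0

def qq (s : ℂ) : ℂ := dd (s ^ 2) * (2 - Complex.exp (Complex.I * s ^ 2))

def hh (s : ℂ) : ℂ :=
  -4 * s * qq s + 2 * (3 - 2 * Complex.exp (Complex.I * s ^ 2)) * qq s ^ (2⁻¹ : ℂ)

lemma dd_diff : Differentiable ℂ dd := by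
  have h := (Complex.differentiableOn_dslope (f := fun u : ℂ => 1 - Complex.exp (Complex.I * u))
    (c := 0) (s := Set.univ) Filter.univ_mem).2 (by
      apply Differentiable.differentiableOn; fun_prop)
  exact differentiableOn_univ.1 h

lemma mul_dd (u : ℂ) : u * dd u = 1 - Complex.exp (Complex.I * u) := by
  have := sub_smul_dslope (fun u : ℂ => 1 - Complex.exp (Complex.I * u)) 0 u
  simpa [dd] using this

lemma dd_zero : dd 0 = -Complex.I := by
  unfold dd
  rw [dslope_same]
  have h : HasDerivAt (fun u : ℂ => 1 - Complex.exp (Complex.I * u)) (-Complex.I) 0 := by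
    have h1 : HasDerivAt (fun u : ℂ => Complex.I * u) Complex.I 0 := by
      simpa using (hasDerivAt_id (0 : ℂ)).const_mul Complex.I
    simpa using h1.cexp.const_sub 1
  exact h.deriv

lemma qq_diff : Differentiable ℂ qq := by
  unfold qq
  have := dd_diff
  fun_prop

lemma hh_analytic {s : ℂ} (hs : qq s ∈ slitPlane) : AnalyticAt ℂ hh s := by
  have h1 : AnalyticAt ℂ qq s := qq_diff.analyticAt s
  unfold hh
  have h2 : AnalyticAt ℂ (fun s => qq s ^ (2⁻¹ : ℂ)) s := h1.cpow analyticAt_const hs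
  have h3 : AnalyticAt ℂ (fun s : ℂ => -4 * s) s := by fun_prop
  have h4 : AnalyticAt ℂ (fun s : ℂ => 2 * (3 - 2 * Complex.exp (Complex.I * s ^ 2))) s :=
    Differentiable.analyticAt (by fun_prop) s
  exact (h3.mul h1).add (h4.mul h2)

lemma exp_I_mul (t : ℝ) : Complex.exp (Complex.I * t) = Real.cos t + Real.sin t * Complex.I := by
  rw [mul_comm, Complex.exp_mul_I]; simp

lemma sq_mul_qq (s : ℂ) : 4 * s ^ 2 * qq s = (3 - 2 * Complex.exp (Complex.I * s ^ 2)) ^ 2 - 1 := by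
  unfold qq
  linear_combination 4 * (2 - Complex.exp (Complex.I * s ^ 2)) * mul_dd (s ^ 2)

lemma w_re (t : ℝ) : (wFn t).re = 3 - 2 * Real.cos t := by
  simp [wFn, exp_I_mul, -Complex.ofReal_cos, -Complex.ofReal_sin]

lemma w_im (t : ℝ) : (wFn t).im = - 2 * Real.sin t := by
  simp [wFn, exp_I_mul, -Complex.ofReal_cos, -Complex.ofReal_sin]

lemma wFn_sq (s : ℝ) : wFn (s ^ 2) = 3 - 2 * Complex.exp (Complex.I * (s : ℂ) ^ 2) := by
  simp [wFn]

lemma re_sqrt_pos {z : ℂ} (hz : z ∈ slitPlane) : 0 < (z ^ (2⁻¹ : ℂ)).re := by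
  rw [Complex.cpow_inv_two_re]
  apply Real.sqrt_pos.2
  have : -z.re < ‖z‖ := by
    have h1 := Complex.abs_re_le_norm z
    rcases Complex.mem_slitPlane_iff.1 hz with h | h
    · linarith [norm_nonneg z]
    · have := (Complex.abs_re_lt_norm (z := z)).2 h
      exact lt_of_le_of_lt (neg_le_abs _) this
  linarith

lemma w_sub_one_mem {t : ℝ} (h0 : 0 < t) (h1 : t ≤ Real.pi) :
    wFn t ^ 2 - 1 ∈ slitPlane ∧ (wFn t ^ 2 - 1).im ≤ 0 := by
  have him : (wFn t ^ 2 - 1).im = 2 * (3 - 2 * Real.cos t) * (- 2 * Real.sin t) := by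
    simp [sq, w_re, w_im]; ring
  have hc := Real.cos_le_one t
  rcases eq_or_lt_of_le h1 with h | h
  · subst h
    refine ⟨?_, by rw [him]; simp⟩
    rw [Complex.mem_slitPlane_iff]
    left
    simp [sq, w_re, w_im]; norm_num
  · have hs := Real.sin_pos_of_pos_of_lt_pi h0 h
    have : (wFn t ^ 2 - 1).im < 0 := by rw [him]; nlinarith
    exact ⟨Complex.mem_slitPlane_iff.2 (Or.inr this.ne), this.le⟩

lemma phi_lt_one {t : ℝ} (h0 : 0 < t) (h1 : t ≤ Real.pi) : phiFn t < 1 := by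
  obtain ⟨hm, hi⟩ := w_sub_one_mem h0 h1
  have hwr := w_re t
  have hwi := w_im t
  have hc := Real.cos_le_one t
  have hsin := Real.sin_nonneg_of_nonneg_of_le_pi h0.le h1
  have hS := re_sqrt_pos hm
  have hSS : ((wFn t ^ 2 - 1) ^ (2⁻¹ : ℂ)) ^ 2 = wFn t ^ 2 - 1 := Complex.cpow_ofNat_inv_pow _ 2
  unfold phiFn
  rw [one_div]
  generalize (wFn t ^ 2 - 1) ^ (2⁻¹ : ℂ) = S at *
  generalize wFn t = w at *
  have hSi : S.im ≤ 0 := by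
    rw [← hSS, sq, Complex.mul_im] at hi
    by_contra hcon
    push Not at hcon
    nlinarith [mul_pos hS hcon]
  have hprod : ‖w - S‖ * ‖w + S‖ = 1 := by
    rw [← norm_mul]
    have : (w - S) * (w + S) = 1 := by linear_combination -hSS
    rw [this, norm_one]
  have hlt : ‖w - S‖ ^ 2 < ‖w + S‖ ^ 2 := by
    rw [← Complex.normSq_eq_norm_sq, ← Complex.normSq_eq_norm_sq, Complex.normSq_apply,
      Complex.normSq_apply]
    simp only [Complex.sub_re, Complex.sub_im, Complex.add_re, Complex.add_im]
    have h1 : 0 < w.re * S.re := by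
      apply mul_pos _ hS; rw [hwr]; linarith
    have h2 : 0 ≤ w.im * S.im := by
      apply mul_nonneg_of_nonpos_of_nonpos _ hSi; rw [hwi]; linarith
    nlinarith
  have hl : ‖w - S‖ < 1 := by
    have := lt_of_pow_lt_pow_left₀ 2 (norm_nonneg _) hlt
    by_contra hcon
    push Not at hcon
    nlinarith
  have hsq : w ^ 2 - w * S = (1 + (w - S) ^ 2) / 2 := by
    linear_combination (-1 / 2) * hSS
  have hre : ((w - S) ^ 2).re < 1 := by
    refine lt_of_le_of_lt (Complex.re_le_norm _) ?_
    rw [norm_pow]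
    exact pow_lt_one₀ (norm_nonneg _) hl (by norm_num)
  rw [hsq]
  have : ((1 + (w - S) ^ 2) / 2).re = (1 + ((w - S) ^ 2).re) / 2 := by
    rw [show (2 : ℂ) = ((2 : ℝ) : ℂ) by simp, Complex.div_ofReal_re]; simp
  rw [this]; linarith

lemma qq_zero : qq 0 = -Complex.I := by
  simp [qq, dd_zero]; norm_num

lemma qq_mem {s : ℝ} (h0 : 0 ≤ s) (h1 : s ^ 2 ≤ Real.pi) : qq s ∈ slitPlane := by
  rcases eq_or_lt_of_le h0 with h | h
  · subst h
    rw [Complex.ofReal_zero, qq_zero, Complex.mem_slitPlane_iff]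
    right; simp
  · have hm := (w_sub_one_mem (t := s ^ 2) (by positivity) h1).1
    rw [wFn_sq, ← sq_mul_qq] at hm
    have h4 : (4 * (s : ℂ) ^ 2 * qq s) = ((4 * s ^ 2 : ℝ) : ℂ) * qq s := by push_cast; ring
    have hp : 0 < 4 * s ^ 2 := by positivity
    rw [h4, Complex.mem_slitPlane_iff, Complex.re_ofReal_mul, Complex.im_ofReal_mul] at hm
    rw [Complex.mem_slitPlane_iff]
    rcases hm with hm | hm
    · left; exact (mul_pos_iff_of_pos_left hp).1 hm
    · right; exact right_ne_zero_of_mul hm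

lemma one_sub_phi {s : ℝ} (h0 : 0 < s) (h1 : s ^ 2 ≤ Real.pi) :
    1 - phiFn (s ^ 2) = s * (hh s).re := by
  have hq := qq_mem h0.le h1
  have hR := re_sqrt_pos hq
  have hRR : (qq s ^ (2⁻¹ : ℂ)) ^ 2 = qq s := Complex.cpow_ofNat_inv_pow _ 2
  have hS : (wFn (s ^ 2) ^ 2 - 1) ^ (2⁻¹ : ℂ) = 2 * s * qq s ^ (2⁻¹ : ℂ) := by
    have : wFn (s ^ 2) ^ 2 - 1 = (2 * s * qq s ^ (2⁻¹ : ℂ)) ^ 2 := by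
      rw [wFn_sq, ← sq_mul_qq, mul_pow, hRR]; ring
    rw [this]
    have hre : 0 < (2 * s * qq s ^ (2⁻¹ : ℂ)).re := by
      rw [show (2 * s : ℂ) = ((2 * s : ℝ) : ℂ) by push_cast; ring, Complex.re_ofReal_mul]
      positivity
    have harg := abs_lt.1 (Complex.abs_arg_lt_pi_div_two_iff.2 (Or.inl hre))
    exact Complex.pow_cpow_ofNat_inv harg.1 harg.2.le
  unfold phiFn
  rw [one_div, hS, ← Complex.re_ofReal_mul, ← Complex.one_re, ← Complex.sub_re]
  congr 1
  unfold hh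
  rw [← wFn_sq]
  have := sq_mul_qq s
  rw [← wFn_sq] at this
  linear_combination this

lemma hh_re_pos {s : ℝ} (h0 : 0 ≤ s) (h1 : s ^ 2 ≤ Real.pi) : 0 < (hh s).re := by
  rcases eq_or_lt_of_le h0 with h | h
  · subst h
    have := re_sqrt_pos (qq_mem le_rfl h1)
    unfold hh
    simp only [Complex.ofReal_zero] at *
    norm_num
    simpa only [one_div] using this
  · have := one_sub_phi h h1
    have h2 := phi_lt_one (t := s ^ 2) (by positivity) h1
    have : 0 < s * (hh s).re := by linarith
    exact (mul_pos_iff_of_pos_left h).1 this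

lemma gamma_eq (x : ℝ) :
    gammaFn x = ∫ s in (0 : ℝ)..√Real.pi, Real.cos (x * s ^ 2) * (2 / (hh s).re) := by
  unfold gammaFn
  have hpi := Real.pi_pos
  rw [intervalIntegral.integral_of_le hpi.le, intervalIntegral.integral_of_le (Real.sqrt_nonneg _)]
  have himg : (fun s : ℝ => s ^ 2) '' Set.Ioc 0 (√Real.pi) = Set.Ioc 0 Real.pi := by
    ext t
    constructor
    · rintro ⟨s, ⟨h0, h1⟩, rfl⟩
      exact ⟨by positivity, (Real.le_sqrt h0.le hpi.le).1 h1⟩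
    · rintro ⟨h0, h1⟩
      exact ⟨√t, ⟨Real.sqrt_pos.2 h0, Real.sqrt_le_sqrt h1⟩, Real.sq_sqrt h0.le⟩
  rw [← himg, MeasureTheory.integral_image_eq_integral_abs_deriv_smul measurableSet_Ioc
    (f' := fun s => 2 * s)]
  · apply MeasureTheory.setIntegral_congr_fun measurableSet_Ioc
    rintro s ⟨h0, h1⟩
    have h2 : s ^ 2 ≤ Real.pi := (Real.le_sqrt h0.le hpi.le).1 h1
    have h3 := hh_re_pos h0.le h2
    simp only [smul_eq_mul]
    rw [one_sub_phi h0 h2, abs_of_pos (by positivity)]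
    field_simp
  · intro s _
    simpa using (hasDerivAt_pow 2 s).hasDerivWithinAt
  · intro a ha b hb hab
    exact (sq_eq_sq₀ ha.1.le hb.1.le).1 hab

/-- The limit of `√x · γ(x)` as `x → ∞` exists and is nonzero. -/
theorem sqrt_mul_gamma_tendsto :
    ∃ L : ℝ, L ≠ 0 ∧
      Tendsto (fun x : ℝ => Real.sqrt x * gammaFn x) atTop (nhds L) := by
  obtain ⟨c, hc, hf⟩ := fres_tendsto
  have hpi := Real.pi_pos
  have hsq : ∀ s ∈ Set.Icc 0 (√Real.pi), s ^ 2 ≤ Real.pi := fun s hs =>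
    (Real.le_sqrt hs.1 hpi.le).1 hs.2
  have han : ∀ s ∈ Set.Icc 0 (√Real.pi), AnalyticAt ℝ (fun s : ℝ => 2 / (hh s).re) s :=
    fun s hs => analyticAt_const.div (hh_analytic (qq_mem hs.1 (hsq s hs))).re_ofReal
      (hh_re_pos hs.1 (hsq s hs)).ne'
  refine ⟨c * (2 / (hh (0 : ℝ)).re), ?_, ?_⟩
  · have := hh_re_pos (s := 0) le_rfl (by simpa using hpi.le)
    positivity
  · have := fres_asymp (fun s : ℝ => 2 / (hh s).re) (√Real.pi) (Real.sqrt_pos.2 hpi)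
      (fun s hs => (han s hs).differentiableAt)
      (fun s hs => (han s hs).deriv.continuousAt.continuousWithinAt) hf
    simpa only [gamma_eq] using this
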